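/- arXiv:1603.07319 — 2 statements merged into one kernel-verified Lean document; each statement's English description precedes it below -/
import Mathlib

section
/- In the binary peer-prediction model, there exist q* ∈ (q10, q11) and r > 0 such that for every α > 0 and every γ ∈ ℝ, in the mechanism with payoff functions ℓ(x,1) = α(x − q*) + γ and ℓ(x,0) = −(α/r)(x − q*) + γ, the common expected payoff of the truth-telling symmetric equilibrium (every agent plays (0,1)) is at least the common expected payoff of every informative equilibrium (every equilibrium other than the all-0 profile (0,0) and the all-1 profile (1,1)). Moreover, if q10 ≠ q01, then q* and r can be chosen so that (with q* ≠ q11 and q* ≠ q00) truth-telling's payoff is strictly greater than that of every other informative equilibrium. -/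
open Finset

noncomputable section

/-- A real function is affine. -/
def IsAffineFn (f : ℝ → ℝ) : Prop := ∃ a b : ℝ, ∀ x, f x = a * x + b

/-- A (mixed) strategy `s = (θ(1|0), θ(1|1))` is valid if both coordinates lie in `[0,1]`. -/
def ValidStrat (s : ℝ × ℝ) : Prop := s.1 ∈ Set.Icc (0 : ℝ) 1 ∧ s.2 ∈ Set.Icc (0 : ℝ) 1

/-- Induced report probability `q̂(1|0) = θ(1|0)·q00 + θ(1|1)·q10`, where `q00 = 1 - q10`. -/
def qhat0 (q10 : ℝ) (s : ℝ × ℝ) : ℝ := s.1 * (1 - q10) + s.2 * q10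

/-- Induced report probability `q̂(1|1) = θ(1|0)·q01 + θ(1|1)·q11`, where `q01 = 1 - q11`. -/
def qhat1 (q11 : ℝ) (s : ℝ × ℝ) : ℝ := s.1 * (1 - q11) + s.2 * q11

/-- Expected payoff of agent `i` under profile `θ`, where `ℓ0 = ℓ(·,0)` and `ℓ1 = ℓ(·,1)`
are the two payoff functions of the mechanism,
`q1 = q10/(1 - q11 + q10)` is the marginal probability of signal `1` and `q0 = 1 - q1`:
`ν_i(θ) = Σ_{b∈{0,1}} q_b·[(1−θ_i(1|b))·(1/(n−1))Σ_{j≠i} ℓ(q̂_j(1|b),0)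
                           + θ_i(1|b)·(1/(n−1))Σ_{j≠i} ℓ(q̂_j(1|b),1)]`. -/
def payoff (n : ℕ) (q10 q11 : ℝ) (ℓ0 ℓ1 : ℝ → ℝ) (θ : Fin n → ℝ × ℝ) (i : Fin n) : ℝ :=
  (1 - q10 / (1 - q11 + q10)) *
      ((1 - (θ i).1) * (((n : ℝ) - 1)⁻¹ * ∑ j ∈ univ.erase i, ℓ0 (qhat0 q10 (θ j)))
        + (θ i).1 * (((n : ℝ) - 1)⁻¹ * ∑ j ∈ univ.erase i, ℓ1 (qhat0 q10 (θ j))))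
    + (q10 / (1 - q11 + q10)) *
      ((1 - (θ i).2) * (((n : ℝ) - 1)⁻¹ * ∑ j ∈ univ.erase i, ℓ0 (qhat1 q11 (θ j)))
        + (θ i).2 * (((n : ℝ) - 1)⁻¹ * ∑ j ∈ univ.erase i, ℓ1 (qhat1 q11 (θ j))))

/-- `θ` is a (Bayesian Nash) equilibrium of the peer-prediction mechanism: every agent plays
a valid strategy, and no agent can improve her expected payoff by a unilateral deviation. -/
def IsEquilibrium (n : ℕ) (q10 q11 : ℝ) (ℓ0 ℓ1 : ℝ → ℝ) (θ : Fin n → ℝ × ℝ) : Prop :=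
  (∀ i, ValidStrat (θ i)) ∧
  ∀ (i : Fin n) (s : ℝ × ℝ), ValidStrat s →
    payoff n q10 q11 ℓ0 ℓ1 θ i ≥ payoff n q10 q11 ℓ0 ℓ1 (Function.update θ i s) i

/-- Unnormalised, rescaled payoff at a symmetric profile. -/
def Wfun (p q w qs a b : ℝ) : ℝ :=
  (1 - q) * ((1 - a) * (-w * (a * (1 - p) + b * p - qs)) + a * (a * (1 - p) + b * p - qs))
  + p * ((1 - b) * (-w * (a * (1 - q) + b * q - qs)) + b * (a * (1 - q) + b * q - qs))

lemma core (P : ℝ → Prop) (hP : ∀ x, 0 < x → P x) (p q w qs a b : ℝ)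
    (hp : 0 < p) (hpq : p < q) (hq : q < 1) (hs1 : p < qs) (hs2 : qs < q)
    (hw1 : p / (1 - p) < w) (hw2 : w < q / (1 - q))
    (h3 : 1 - q ≤ qs → qs ≤ 1 - p → P ((1 - q - p) * (qs * (1 + w) - 1)))
    (h4 : 1 - q ≤ qs → P ((1 - q - p) * (qs * (1 + w) - 1)
      + p * (qs - (1 - q)) * (w - (1 - q) / q)))
    (h5 : qs ≤ 1 - p → P ((1 - q - p) * (qs * (1 + w) - 1)
      + (1 - q) * (1 - p - qs) * (1 - w * (p / (1 - p)))))
    (ha0 : 0 ≤ a) (ha1 : a ≤ 1) (hb0 : 0 ≤ b) (hb1 : b ≤ 1)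
    (hA0 : 0 ≤ a * (a * (1 - p) + b * p - qs)) (hA1 : (1 - a) * (a * (1 - p) + b * p - qs) ≤ 0)
    (hB0 : 0 ≤ b * (a * (1 - q) + b * q - qs)) (hB1 : (1 - b) * (a * (1 - q) + b * q - qs) ≤ 0)
    (n00 : ¬ (a = 0 ∧ b = 0)) (n11 : ¬ (a = 1 ∧ b = 1)) (n01 : ¬ (a = 0 ∧ b = 1)) :
    P (Wfun p q w qs 0 1 - Wfun p q w qs a b) := by
  have hp1 : 0 < 1 - p := by linarith
  have hq1 : 0 < 1 - q := by linarith
  have hq0 : 0 < q := by linarith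
  have hw0 : 0 < w := lt_trans (by positivity) hw1
  have neg0 : ∀ x D : ℝ, 0 ≤ x → 0 ≤ x * D → D < 0 → x = 0 := by
    intro x D hx h hD
    by_contra hne
    have : 0 < x := lt_of_le_of_ne hx (Ne.symm hne)
    nlinarith
  have pos1 : ∀ x D : ℝ, x ≤ 1 → (1 - x) * D ≤ 0 → 0 < D → x = 1 := by
    intro x D hx h hD
    by_contra hne
    have : x < 1 := lt_of_le_of_ne hx hne
    nlinarith
  rcases lt_trichotomy (a * (1 - p) + b * p - qs) 0 with h0 | h0 | h0 <;>
  rcases lt_trichotomy (a * (1 - q) + b * q - qs) 0 with h1 | h1 | h1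
  · exact absurd ⟨neg0 _ _ ha0 hA0 h0, neg0 _ _ hb0 hB0 h1⟩ n00
  · have := neg0 _ _ ha0 hA0 h0
    subst this
    have hb : b = qs / q := by field_simp; linarith
    apply hP
    have : Wfun p q w qs 0 1 - Wfun p q w qs 0 b
        = (q - qs) * p * (1 - q) / q * (q / (1 - q) - w) := by
      subst hb; unfold Wfun; field_simp; ring
    rw [this]
    have := sub_pos.2 hw2
    have := sub_pos.2 hs2
    positivity
  · exact absurd ⟨neg0 _ _ ha0 hA0 h0, pos1 _ _ hb1 hB1 h1⟩ n01
  · have := neg0 _ _ hb0 hB0 h1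
    subst this
    have ha : a = qs / (1 - p) := by field_simp; linarith
    have hle : qs ≤ 1 - p := by nlinarith
    convert h5 hle using 1
    subst ha; unfold Wfun; field_simp; ring
  · apply hP
    unfold Wfun
    rw [h0, h1]
    have := sub_pos.2 hs2
    have := sub_pos.2 hs1
    have : 0 < (1 - q) * w * (qs - p) + p * (q - qs) := by positivity
    linarith
  · have := pos1 _ _ hb1 hB1 h1
    subst this
    have ha : a = (qs - p) / (1 - p) := by field_simp; linarith
    apply hP
    have : Wfun p q w qs 0 1 - Wfun p q w qs a 1
        = (1 - q) * (qs - p) * (w - p / (1 - p)) := by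
      subst ha; unfold Wfun; field_simp; ring
    rw [this]
    have := sub_pos.2 hw1
    have := sub_pos.2 hs1
    positivity
  · have := neg0 _ _ hb0 hB0 h1
    have := pos1 _ _ ha1 hA1 h0
    subst a b
    convert h3 (by linarith) (by linarith) using 1
    unfold Wfun; ring
  · have := pos1 _ _ ha1 hA1 h0
    subst this
    have hb : b = (qs - (1 - q)) / q := by field_simp; linarith
    have hle : 1 - q ≤ qs := by nlinarith
    convert h4 hle using 1
    subst hb; unfold Wfun; field_simp; ring
  · exact absurd ⟨pos1 _ _ ha1 hA1 h0, pos1 _ _ hb1 hB1 h1⟩ n11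

lemma avg_eq (n : ℕ) (hn : 2 ≤ n) (i : Fin n) (c qs γ : ℝ) (f : Fin n → ℝ) :
    ((n : ℝ) - 1)⁻¹ * ∑ j ∈ univ.erase i, (c * (f j - qs) + γ)
      = c * (((n : ℝ) - 1)⁻¹ * ((∑ j, f j) - f i) - qs) + γ := by
  have hn' : (2 : ℝ) ≤ n := by exact_mod_cast hn
  have h1 : (n : ℝ) - 1 ≠ 0 := by linarith
  have hs : ∑ j ∈ univ.erase i, f j = (∑ j, f j) - f i := by
    rw [← Finset.add_sum_erase univ f (Finset.mem_univ i)]; ring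
  rw [Finset.sum_add_distrib, ← Finset.mul_sum, Finset.sum_sub_distrib, hs]
  simp only [Finset.sum_const, Finset.card_erase_of_mem (Finset.mem_univ i), Finset.card_univ,
    Fintype.card_fin, nsmul_eq_mul]
  rw [Nat.cast_sub (by omega)]
  push_cast
  field_simp

lemma payoff_upd (n : ℕ) (hn : 2 ≤ n) (p q c α qs γ : ℝ) (θ : Fin n → ℝ × ℝ) (i : Fin n)
    (s : ℝ × ℝ) :
    payoff n p q (fun x => c * (x - qs) + γ) (fun x => α * (x - qs) + γ)
      (Function.update θ i s) i =
    (1 - p / (1 - q + p)) *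
      ((1 - s.1) * (c * (((n : ℝ) - 1)⁻¹ * ((∑ j, qhat0 p (θ j)) - qhat0 p (θ i)) - qs) + γ)
        + s.1 * (α * (((n : ℝ) - 1)⁻¹ * ((∑ j, qhat0 p (θ j)) - qhat0 p (θ i)) - qs) + γ))
    + (p / (1 - q + p)) *
      ((1 - s.2) * (c * (((n : ℝ) - 1)⁻¹ * ((∑ j, qhat1 q (θ j)) - qhat1 q (θ i)) - qs) + γ)
        + s.2 * (α * (((n : ℝ) - 1)⁻¹ * ((∑ j, qhat1 q (θ j)) - qhat1 q (θ i)) - qs) + γ)) := by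
  have key : ∀ (d : ℝ) (g : ℝ × ℝ → ℝ),
      ∑ j ∈ univ.erase i, (d * (g (Function.update θ i s j) - qs) + γ)
        = ∑ j ∈ univ.erase i, (d * (g (θ j) - qs) + γ) := by
    intro d g
    refine Finset.sum_congr rfl fun j hj => ?_
    rw [Function.update_of_ne (Finset.ne_of_mem_erase hj)]
  unfold payoff
  simp only [Function.update_self]
  rw [key c (qhat0 p), key c (qhat1 q), key α (qhat0 p), key α (qhat1 q)]
  simp only [avg_eq n hn i]

lemma payoff_const (n : ℕ) (hn : 2 ≤ n) (p q w α qs γ a b : ℝ) (i : Fin n)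
    (hp : 0 < p) (hq : q < 1) :
    payoff n p q (fun x => -(α * w) * (x - qs) + γ) (fun x => α * (x - qs) + γ)
      (fun _ => (a, b)) i = α / (1 - q + p) * Wfun p q w qs a b + γ := by
  have h := payoff_upd n hn p q (-(α * w)) α qs γ (fun _ => (a, b)) i (a, b)
  have e : Function.update (fun _ : Fin n => (a, b)) i (a, b) = fun _ => (a, b) :=
    Function.update_eq_self i _
  rw [e] at h
  rw [h]
  have hn' : (2 : ℝ) ≤ n := by exact_mod_cast hn
  have h1 : (n : ℝ) - 1 ≠ 0 := by linarith
  have key : ∀ x : ℝ, ((n : ℝ) - 1)⁻¹ * ((∑ _j : Fin n, x) - x) = x := by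
    intro x
    simp only [Finset.sum_const, Finset.card_univ, Fintype.card_fin, nsmul_eq_mul]
    field_simp
  rw [key, key]
  have : 1 - q + p ≠ 0 := by linarith
  unfold Wfun qhat0 qhat1
  field_simp
  ring

lemma eq_const (n : ℕ) (hn : 2 ≤ n) (p q w α qs γ : ℝ) (θ : Fin n → ℝ × ℝ)
    (hp : 0 < p) (hpq : p < q) (hq : q < 1) (hw : 0 < w) (hα : 0 < α)
    (hE : IsEquilibrium n p q (fun x => -(α * w) * (x - qs) + γ) (fun x => α * (x - qs) + γ) θ) :
    ∃ a b : ℝ, θ = (fun _ => (a, b)) ∧ 0 ≤ a ∧ a ≤ 1 ∧ 0 ≤ b ∧ b ≤ 1 ∧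
      0 ≤ a * (a * (1 - p) + b * p - qs) ∧ (1 - a) * (a * (1 - p) + b * p - qs) ≤ 0 ∧
      0 ≤ b * (a * (1 - q) + b * q - qs) ∧ (1 - b) * (a * (1 - q) + b * q - qs) ≤ 0 := by
  obtain ⟨hv, hd⟩ := hE
  have hn' : (2 : ℝ) ≤ n := by exact_mod_cast hn
  have hn1 : 0 < ((n : ℝ) - 1)⁻¹ := inv_pos.2 (by linarith)
  have hden : 0 < 1 - q + p := by linarith
  have hq1 : 0 < p / (1 - q + p) := by positivity
  have hq0 : 0 < 1 - p / (1 - q + p) := by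
    rw [sub_pos, div_lt_one hden]; linarith
  set S0 := ∑ j, qhat0 p (θ j) with hS0
  set S1 := ∑ j, qhat1 q (θ j) with hS1
  have dev : ∀ i, ∀ s, ValidStrat s →
      (1 - p / (1 - q + p)) * (α * (1 + w)) * ((s.1 - (θ i).1) *
        (((n : ℝ) - 1)⁻¹ * (S0 - qhat0 p (θ i)) - qs))
      + (p / (1 - q + p)) * (α * (1 + w)) * ((s.2 - (θ i).2) *
        (((n : ℝ) - 1)⁻¹ * (S1 - qhat1 q (θ i)) - qs)) ≤ 0 := by
    intro i s hs
    have h := hd i s hs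
    have h2 := payoff_upd n hn p q (-(α * w)) α qs γ θ i (θ i)
    rw [Function.update_eq_self] at h2
    rw [payoff_upd n hn, h2] at h
    linarith
  have hc0 : 0 < (1 - p / (1 - q + p)) * (α * (1 + w)) := by positivity
  have hc1 : 0 < (p / (1 - q + p)) * (α * (1 + w)) := by positivity
  have dA : ∀ i, ∀ s, 0 ≤ s → s ≤ 1 → (s - (θ i).1) *
        (((n : ℝ) - 1)⁻¹ * (S0 - qhat0 p (θ i)) - qs) ≤ 0 := by
    intro i s h0 h1
    have := dev i (s, (θ i).2) ⟨⟨h0, h1⟩, (hv i).2⟩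
    simp only [sub_self, zero_mul, mul_zero, add_zero] at this
    exact nonpos_of_mul_nonpos_right this hc0
  have dB : ∀ i, ∀ s, 0 ≤ s → s ≤ 1 → (s - (θ i).2) *
        (((n : ℝ) - 1)⁻¹ * (S1 - qhat1 q (θ i)) - qs) ≤ 0 := by
    intro i s h0 h1
    have := dev i ((θ i).1, s) ⟨(hv i).1, ⟨h0, h1⟩⟩
    simp only [sub_self, zero_mul, mul_zero, zero_add] at this
    exact nonpos_of_mul_nonpos_right this hc1
  have cmpA : ∀ i j, (θ j).1 < (θ i).1 → qhat0 p (θ i) ≤ qhat0 p (θ j) := by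
    intro i j hij
    have h1 := dA i _ (hv j).1.1 (hv j).1.2
    have h2 := dA j _ (hv i).1.1 (hv i).1.2
    have h3 : 0 ≤ ((n : ℝ) - 1)⁻¹ * (S0 - qhat0 p (θ i)) - qs := by
      by_contra! hc; nlinarith
    have h4 : ((n : ℝ) - 1)⁻¹ * (S0 - qhat0 p (θ j)) - qs ≤ 0 := by
      by_contra! hc; nlinarith
    have h5 : ((n : ℝ) - 1)⁻¹ * (S0 - qhat0 p (θ j)) ≤ ((n : ℝ) - 1)⁻¹ * (S0 - qhat0 p (θ i)) := by
      linarith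
    have := le_of_mul_le_mul_left h5 hn1
    linarith
  have cmpB : ∀ i j, (θ j).2 < (θ i).2 → qhat1 q (θ i) ≤ qhat1 q (θ j) := by
    intro i j hij
    have h1 := dB i _ (hv j).2.1 (hv j).2.2
    have h2 := dB j _ (hv i).2.1 (hv i).2.2
    have h3 : 0 ≤ ((n : ℝ) - 1)⁻¹ * (S1 - qhat1 q (θ i)) - qs := by
      by_contra! hc; nlinarith
    have h4 : ((n : ℝ) - 1)⁻¹ * (S1 - qhat1 q (θ j)) - qs ≤ 0 := by
      by_contra! hc; nlinarith
    have h5 : ((n : ℝ) - 1)⁻¹ * (S1 - qhat1 q (θ j)) ≤ ((n : ℝ) - 1)⁻¹ * (S1 - qhat1 q (θ i)) := by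
      linarith
    have := le_of_mul_le_mul_left h5 hn1
    linarith
  have noA : ∀ i j, ¬ (θ j).1 < (θ i).1 := by
    intro i j hij
    have h1 := cmpA i j hij
    unfold qhat0 at h1
    have hb : (θ i).2 < (θ j).2 := by
      by_contra! hc
      nlinarith [mul_pos (sub_pos.2 hij) (by linarith : 0 < 1 - p),
        mul_nonneg (sub_nonneg.2 hc) hp.le]
    have h2 := cmpB j i hb
    unfold qhat1 at h2
    have hx := sub_pos.2 hij
    have hq0' : 0 < q := by linarith
    nlinarith [mul_le_mul_of_nonneg_left h1 hq0'.le, mul_le_mul_of_nonneg_left h2 hp.le,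
      mul_pos hx (sub_pos.2 hpq)]
  have eqA : ∀ i j, (θ i).1 = (θ j).1 := fun i j =>
    le_antisymm (not_lt.1 (noA i j)) (not_lt.1 (noA j i))
  have noB : ∀ i j, ¬ (θ j).2 < (θ i).2 := by
    intro i j hij
    have h1 := cmpB i j hij
    unfold qhat1 at h1
    rw [eqA i j] at h1
    nlinarith
  have eqB : ∀ i j, (θ i).2 = (θ j).2 := fun i j =>
    le_antisymm (not_lt.1 (noB i j)) (not_lt.1 (noB j i))
  let i0 : Fin n := ⟨0, by omega⟩
  have hθ : ∀ j, θ j = θ i0 := fun j => Prod.ext (eqA j i0) (eqB j i0)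
  have e0 : ((n : ℝ) - 1)⁻¹ * (S0 - qhat0 p (θ i0)) = qhat0 p (θ i0) := by
    rw [hS0]
    simp only [hθ, Finset.sum_const, Finset.card_univ, Fintype.card_fin, nsmul_eq_mul]
    have h1 : (n : ℝ) - 1 ≠ 0 := by linarith
    field_simp
  have e1 : ((n : ℝ) - 1)⁻¹ * (S1 - qhat1 q (θ i0)) = qhat1 q (θ i0) := by
    rw [hS1]
    simp only [hθ, Finset.sum_const, Finset.card_univ, Fintype.card_fin, nsmul_eq_mul]
    have h1 : (n : ℝ) - 1 ≠ 0 := by linarith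
    field_simp
  have a0 := dA i0 0 le_rfl zero_le_one
  have a1 := dA i0 1 zero_le_one le_rfl
  have b0 := dB i0 0 le_rfl zero_le_one
  have b1 := dB i0 1 zero_le_one le_rfl
  rw [e0] at a0 a1
  rw [e1] at b0 b1
  unfold qhat0 at a0 a1
  unfold qhat1 at b0 b1
  refine ⟨(θ i0).1, (θ i0).2, funext hθ, (hv i0).1.1, (hv i0).1.2, (hv i0).2.1, (hv i0).2.2,
    by linarith, a1, by linarith, b1⟩

/-- Parameters for which the comparison property `P` holds. -/
def Good (P : ℝ → Prop) (p q w qs : ℝ) : Prop :=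
    p < qs ∧ qs < q ∧ p / (1 - p) < w ∧ w < q / (1 - q) ∧
    (1 - q ≤ qs → qs ≤ 1 - p → P ((1 - q - p) * (qs * (1 + w) - 1))) ∧
    (1 - q ≤ qs → P ((1 - q - p) * (qs * (1 + w) - 1)
      + p * (qs - (1 - q)) * (w - (1 - q) / q))) ∧
    (qs ≤ 1 - p → P ((1 - q - p) * (qs * (1 + w) - 1)
      + (1 - q) * (1 - p - qs) * (1 - w * (p / (1 - p)))))

lemma main_strict (n : ℕ) (hn : 2 ≤ n) (p q w qs α γ : ℝ)
    (hp : 0 < p) (hpq : p < q) (hq : q < 1) (hα : 0 < α)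
    (P : ℝ → Prop) (hP : ∀ x, 0 < x → P x)
    (hG : Good P p q w qs) (θ : Fin n → ℝ × ℝ)
    (hE : IsEquilibrium n p q (fun x => -(α / w⁻¹) * (x - qs) + γ) (fun x => α * (x - qs) + γ) θ)
    (n00 : θ ≠ (fun _ => ((0 : ℝ), (0 : ℝ)))) (n11 : θ ≠ (fun _ => ((1 : ℝ), (1 : ℝ))))
    (n01 : θ ≠ (fun _ => ((0 : ℝ), (1 : ℝ)))) (i : Fin n) :
    ∃ d, P d ∧ payoff n p q (fun x => -(α / w⁻¹) * (x - qs) + γ)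
                (fun x => α * (x - qs) + γ) (fun _ => ((0 : ℝ), (1 : ℝ))) i =
              payoff n p q (fun x => -(α / w⁻¹) * (x - qs) + γ)
                (fun x => α * (x - qs) + γ) θ i + α / (1 - q + p) * d := by
  rw [div_inv_eq_mul] at *
  obtain ⟨g1, g2, g3, g4, g5, g6, g7⟩ := hG
  have hp1 : 0 < 1 - p := by linarith
  have hw : 0 < w := lt_trans (by positivity) g3
  obtain ⟨a, b, rfl, x1, x2, x3, x4, x5, x6, x7, x8⟩ :=
    eq_const n hn p q w α qs γ θ hp hpq hq hw hα hE
  refine ⟨_, core P hP p q w qs a b hp hpq hq g1 g2 g3 g4 g5 g6 g7 x1 x2 x3 x4 x5 x6 x7 x8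
    ?_ ?_ ?_, ?_⟩
  · rintro ⟨rfl, rfl⟩; exact n00 rfl
  · rintro ⟨rfl, rfl⟩; exact n11 rfl
  · rintro ⟨rfl, rfl⟩; exact n01 rfl
  · rw [payoff_const n hn p q w α qs γ _ _ i hp hq, payoff_const n hn p q w α qs γ _ _ i hp hq]
    ring

lemma near (lo hi : ℝ) (h : lo < hi) (A B : ℝ) (hpos : 0 < A * hi + B) :
    ∃ x, lo < x ∧ x < hi ∧ 0 < A * x + B := by
  have hc : Filter.Tendsto (fun x : ℝ => A * x + B) (nhdsWithin hi (Set.Iio hi))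
      (nhds (A * hi + B)) :=
    ((by fun_prop : Continuous fun x : ℝ => A * x + B).tendsto hi).mono_left nhdsWithin_le_nhds
  have h1 := hc.eventually (lt_mem_nhds hpos)
  have h2 : ∀ᶠ x in nhdsWithin hi (Set.Iio hi), x ∈ Set.Ioo lo hi := Ioo_mem_nhdsLT h
  obtain ⟨x, hx, hx2⟩ := (h1.and h2).exists
  exact ⟨x, hx2.1, hx2.2, hx⟩

lemma good_eq (p q : ℝ) (hp : 0 < p) (hpq : p < q) (hq : q < 1) (he : p = 1 - q) :
    Good (fun x => 0 ≤ x) p q 1 (1 / 2) := by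
  have hq' : q = 1 - p := by linarith
  subst hq'
  have hp1 : 0 < 1 - p := by linarith
  refine ⟨by linarith, by linarith, ?_, ?_, ?_, ?_, ?_⟩
  · rw [div_lt_one hp1]; linarith
  · rw [lt_div_iff₀ (by linarith)]; linarith
  · intros; simp
  · intros
    have : (1 - (1 - p)) / (1 - p) ≤ 1 := by rw [div_le_one hp1]; linarith
    have h2 := mul_nonneg (mul_nonneg hp.le (by linarith : 0 ≤ 1 / 2 - (1 - (1 - p))))
      (sub_nonneg.2 this)
    linarith
  · intros
    have : p / (1 - p) ≤ 1 := by rw [div_le_one hp1]; linarith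
    have h2 := mul_nonneg (mul_nonneg hp.le (by linarith : 0 ≤ 1 - p - 1 / 2))
      (sub_nonneg.2 this)
    linarith

lemma good_ne (p q : ℝ) (hp : 0 < p) (hpq : p < q) (hq : q < 1) (he : p ≠ 1 - q) :
    ∃ w qs, Good (fun x => 0 < x) p q w qs ∧ qs ≠ 1 - p := by
  have hp1 : 0 < 1 - p := by linarith
  have hq1 : 0 < 1 - q := by linarith
  have hq0 : 0 < q := by linarith
  -- the choice w = 1
  have one : ∀ qs, p < qs → qs < q → p < 1 / 2 → 1 / 2 < q →
      0 < (1 - q - p) * (qs * (1 + 1) - 1) → Good (fun x => 0 < x) p q 1 qs := by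
    intro qs h1 h2 h3 h4 h5
    refine ⟨h1, h2, ?_, ?_, fun _ _ => h5, ?_, ?_⟩
    · rw [div_lt_one hp1]; linarith
    · rw [lt_div_iff₀ hq1]; linarith
    · intro h6
      have : (1 - q) / q ≤ 1 := by rw [div_le_one hq0]; linarith
      have h2 := mul_nonneg (mul_nonneg hp.le (sub_nonneg.2 h6)) (sub_nonneg.2 this)
      linarith
    · intro h6
      have : p / (1 - p) ≤ 1 := by rw [div_le_one hp1]; linarith
      have h2 := mul_nonneg (mul_nonneg hq1.le (sub_nonneg.2 h6)) (sub_nonneg.2 this)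
      linarith
  have wlo : p / (1 - p) < q / (1 - p) := by gcongr
  have whi : q / (1 - p) < q / (1 - q) := by gcongr
  rcases lt_or_gt_of_ne he with h | h
  · rcases lt_or_ge (1 - q) q with h' | h'
    · refine ⟨1, (1 / 2 + q) / 2, one _ (by linarith) (by linarith) (by linarith) (by linarith) ?_,
        by intro hh; linarith⟩
      exact mul_pos (by linarith) (by linarith)
    · obtain ⟨x, x1, x2, x3⟩ := near p q hpq
        ((1 - q - p) * (1 + q / (1 - p)) - (1 - q) * (1 - q / (1 - p) * (p / (1 - p))))
        (-(1 - q - p) + (1 - q) * (1 - p) * (1 - q / (1 - p) * (p / (1 - p)))) (by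
          have : ((1 - q - p) * (1 + q / (1 - p)) - (1 - q) * (1 - q / (1 - p) * (p / (1 - p)))) * q
            + (-(1 - q - p) + (1 - q) * (1 - p) * (1 - q / (1 - p) * (p / (1 - p))))
            = q * (q - p) * ((1 - q) * (1 - p) - p * q) / (1 - p) ^ 2 := by
            field_simp; ring
          rw [this]
          have h1 : 0 < (1 - q) * (1 - p) - p * q := by nlinarith
          have h2 := sub_pos.2 hpq
          positivity)
      refine ⟨q / (1 - p), x, ⟨x1, x2, wlo, whi, ?_, ?_, ?_⟩, by intro hh; linarith⟩
      · intro hh; linarith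
      · intro hh; linarith
      · intro hh; linarith
  · rcases lt_or_ge p (1 - p) with h' | h'
    · refine ⟨1, (1 / 2 + p) / 2, one _ (by linarith) (by linarith) (by linarith) (by linarith) ?_,
        by intro hh; linarith⟩
      exact mul_pos_of_neg_of_neg (by linarith) (by linarith)
    · set A := (1 - q - p) * (1 + q / (1 - p)) + p * (q / (1 - p) - (1 - q) / q) with hA
      set B := -(1 - q - p) - p * (1 - q) * (q / (1 - p) - (1 - q) / q) with hB
      obtain ⟨x, x1, x2, x3⟩ := near (-q) (-p) (by linarith) (-A) B (by
          have : -A * -p + B = (q - p) * (p * q - (1 - q) * (1 - p)) / q := by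
            rw [hA, hB]; field_simp; ring
          rw [this]
          have h1 : 0 < p * q - (1 - q) * (1 - p) := by nlinarith
          have h2 := sub_pos.2 hpq
          positivity)
      refine ⟨q / (1 - p), -x, ⟨by linarith, by linarith, wlo, whi, ?_, ?_, ?_⟩,
        by intro hh; linarith⟩
      · intro _ hh; linarith
      · intro hh; rw [hA, hB] at x3; linarith
      · intro hh; linarith

/-- **Truth-telling beats every informative equilibrium (Theorem 5.2).**
There exist `q* ∈ (q10, q11)` and `r > 0` such that for every `α > 0` and `γ`, in the
mechanism with `ℓ(x,1) = α(x − q*) + γ` and `ℓ(x,0) = −(α/r)(x − q*) + γ`, truth-telling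
(the constant profile `(0,1)`) pays at least as much as every informative equilibrium
(every equilibrium other than all-`(0,0)` and all-`(1,1)`).  Moreover, if `q10 ≠ q01`
then `q*` (with `q* ≠ q11` and `q* ≠ q00`) and `r` can be chosen so that truth-telling
pays strictly more than every other informative equilibrium. -/
theorem truthtelling_focal_among_informative (n : ℕ) (hn : 2 ≤ n) (q10 q11 : ℝ)
    (hq10 : 0 < q10) (hcorr : q10 < q11) (hq11 : q11 < 1) :
    (∃ qs ∈ Set.Ioo q10 q11, ∃ r : ℝ, 0 < r ∧
      ∀ α : ℝ, 0 < α → ∀ γ : ℝ,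
        ∀ θ : Fin n → ℝ × ℝ,
          IsEquilibrium n q10 q11 (fun x => -(α / r) * (x - qs) + γ)
              (fun x => α * (x - qs) + γ) θ →
          θ ≠ (fun _ => ((0 : ℝ), (0 : ℝ))) → θ ≠ (fun _ => ((1 : ℝ), (1 : ℝ))) →
          ∀ i, payoff n q10 q11 (fun x => -(α / r) * (x - qs) + γ)
                (fun x => α * (x - qs) + γ) (fun _ => ((0 : ℝ), (1 : ℝ))) i ≥
              payoff n q10 q11 (fun x => -(α / r) * (x - qs) + γ)
                (fun x => α * (x - qs) + γ) θ i) ∧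
    (q10 ≠ 1 - q11 →
      ∃ qs ∈ Set.Ioo q10 q11, qs ≠ q11 ∧ qs ≠ 1 - q10 ∧ ∃ r : ℝ, 0 < r ∧
        ∀ α : ℝ, 0 < α → ∀ γ : ℝ,
          ∀ θ : Fin n → ℝ × ℝ,
            IsEquilibrium n q10 q11 (fun x => -(α / r) * (x - qs) + γ)
                (fun x => α * (x - qs) + γ) θ →
            θ ≠ (fun _ => ((0 : ℝ), (0 : ℝ))) → θ ≠ (fun _ => ((1 : ℝ), (1 : ℝ))) →
            θ ≠ (fun _ => ((0 : ℝ), (1 : ℝ))) →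
            ∀ i, payoff n q10 q11 (fun x => -(α / r) * (x - qs) + γ)
                  (fun x => α * (x - qs) + γ) (fun _ => ((0 : ℝ), (1 : ℝ))) i >
                payoff n q10 q11 (fun x => -(α / r) * (x - qs) + γ)
                  (fun x => α * (x - qs) + γ) θ i) := by

  have hp1 : 0 < 1 - q10 := by linarith
  have hden : 0 < 1 - q11 + q10 := by linarith
  have hdiv : ∀ α : ℝ, 0 < α → 0 < α / (1 - q11 + q10) := fun α hα => by positivity
  have wpos : ∀ P w qs, Good P q10 q11 w qs → 0 < w⁻¹ := fun P w qs hG =>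
    inv_pos.2 (lt_trans (by positivity) hG.2.2.1)
  have weak : ∃ w qs, Good (fun x => 0 ≤ x) q10 q11 w qs := by
    by_cases he : q10 = 1 - q11
    · exact ⟨_, _, good_eq q10 q11 hq10 hcorr hq11 he⟩
    · obtain ⟨w, qs, ⟨g1, g2, g3, g4, g5, g6, g7⟩, -⟩ := good_ne q10 q11 hq10 hcorr hq11 he
      exact ⟨w, qs, g1, g2, g3, g4, fun h h' => (g5 h h').le, fun h => (g6 h).le,
        fun h => (g7 h).le⟩
  constructor
  · obtain ⟨w, qs, hG⟩ := weak
    refine ⟨qs, ⟨hG.1, hG.2.1⟩, w⁻¹, wpos _ _ _ hG, ?_⟩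
    intro α hα γ θ hE n00 n11 i
    by_cases n01 : θ = (fun _ => ((0 : ℝ), (1 : ℝ)))
    · rw [n01]
    · obtain ⟨d, hd, h⟩ := main_strict n hn q10 q11 w qs α γ hq10 hcorr hq11 hα _
        (fun x hx => hx.le) hG θ hE n00 n11 n01 i
      have := mul_nonneg (hdiv α hα).le hd
      rw [h]
      linarith
  · intro he
    obtain ⟨w, qs, hG, hne⟩ := good_ne q10 q11 hq10 hcorr hq11 he
    refine ⟨qs, ⟨hG.1, hG.2.1⟩, hG.2.1.ne, hne, w⁻¹, wpos _ _ _ hG, ?_⟩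
    intro α hα γ θ hE n00 n11 n01 i
    obtain ⟨d, hd, h⟩ := main_strict n hn q10 q11 w qs α γ hq10 hcorr hq11 hα _
      (fun x hx => hx) hG θ hE n00 n11 n01 i
    have := mul_pos (hdiv α hα) hd
    rw [h]
    linarith
end
end

section
/- Let f, g : ℝ → ℝ be twice continuously differentiable and define PS(p, q) := f(q)·p + g(q). If PS is strictly proper (for every p ∈ ℝ, q ↦ PS(p, q) attains a strict global maximum at q = p), then g'(p) = −f'(p)·p for all p ∈ ℝ and f is monotone nondecreasing on ℝ. Conversely, if f is strictly increasing and g'(p) = −f'(p)·p for all p, then PS is a proper scoring rule: for every p, q ↦ PS(p, q) is maximized at q = p. -/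
noncomputable section

/-- **Characterization of proper scoring rules of the form `PS(p,q) = f(q)·p + g(q)`
(Claim A.2).**  For `f, g` twice continuously differentiable:
if `PS` is strictly proper (for every `p`, `q ↦ PS(p,q)` has a strict global maximum at
`q = p`), then `g'(p) = −f'(p)·p` for all `p` and `f` is monotone nondecreasing;
conversely, if `f` is strictly increasing and `g'(p) = −f'(p)·p` for all `p`, then `PS`
is proper: for every `p`, `q ↦ PS(p,q)` is maximized at `q = p`. -/
theorem affine_form_proper_characterization (f g : ℝ → ℝ)
    (hf : ContDiff ℝ 2 f) (hg : ContDiff ℝ 2 g) :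
    ((∀ p q : ℝ, q ≠ p → f q * p + g q < f p * p + g p) →
      (∀ p : ℝ, deriv g p = -(deriv f p) * p) ∧ Monotone f) ∧
    ((StrictMono f ∧ ∀ p : ℝ, deriv g p = -(deriv f p) * p) →
      ∀ p q : ℝ, f q * p + g q ≤ f p * p + g p) := by
  have df : Differentiable ℝ f := hf.differentiable (by norm_num)
  have dg : Differentiable ℝ g := hg.differentiable (by norm_num)
  have hd : ∀ p q : ℝ, HasDerivAt (fun q => f q * p + g q) (deriv f q * p + deriv g q) q :=
    fun p q => ((df q).hasDerivAt.mul_const p).add (dg q).hasDerivAt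
  refine ⟨fun h => ⟨fun p => ?_, fun a b hab => ?_⟩, fun ⟨hm, h⟩ p q => ?_⟩
  · have hmax : IsLocalMax (fun q => f q * p + g q) p := by
      refine Filter.Eventually.of_forall fun q => ?_
      by_cases hq : q = p
      · rw [hq]
      · exact (h p q hq).le
    have := hmax.hasDerivAt_eq_zero (hd p p)
    linarith
  · rcases hab.eq_or_lt with rfl | hlt
    · exact le_rfl
    · have h1 := h a b hlt.ne'
      have h2 := h b a hlt.ne
      by_contra hc
      push Not at hc
      nlinarith [mul_pos (sub_pos.2 hc) (sub_pos.2 hlt)]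
  · have hf0 : ∀ x, 0 ≤ deriv f x := fun x => hm.monotone.deriv_nonneg
    have hc : Continuous (fun q => f q * p + g q) := 
      continuous_iff_continuousAt.2 fun x => (hd p x).continuousAt
    rcases le_total q p with hqp | hqp
    · refine monotoneOn_of_deriv_nonneg (convex_Iic p) hc.continuousOn
        (fun x _ => (hd p x).differentiableAt.differentiableWithinAt) (fun x hx => ?_)
        (Set.mem_Iic.2 hqp) (Set.mem_Iic.2 le_rfl) hqp
      rw [interior_Iic] at hx
      rw [(hd p x).deriv, h x]
      nlinarith [mul_nonneg (hf0 x) (sub_nonneg.2 (Set.mem_Iio.1 hx).le)]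
    · refine antitoneOn_of_deriv_nonpos (convex_Ici p) hc.continuousOn
        (fun x _ => (hd p x).differentiableAt.differentiableWithinAt) (fun x hx => ?_)
        (Set.mem_Ici.2 le_rfl) (Set.mem_Ici.2 hqp) hqp
      rw [interior_Ici] at hx
      rw [(hd p x).deriv, h x]
      nlinarith [mul_nonneg (hf0 x) (sub_nonneg.2 (Set.mem_Ioi.1 hx).le)]
end
end
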